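/- arXiv:1602.07829 — 2 statements merged into one kernel-verified Lean document; each statement's English description precedes it below -/
import Mathlib

section
/- Let p be a prime and let K = F_{p^p} be the field with p^p elements, viewed as a p-dimensional vector space over F_p. Let G = ΓL(1,p^p) be the subgroup of GL(K) ≅ GL(p,p) generated by all multiplications x ↦ λx for λ ∈ K^× together with the Frobenius map x ↦ x^p; thus G ≅ K^× ⋊ C_p and |G| = (p^p − 1)·p. Then G acts absolutely irreducibly on K (that is, for every field extension E of F_p, the E[G]-module E ⊗_{F_p} K is simple), and c_p(G) = 1. -/
/-- A composition series of a group `G`: an ascending chain of subgroups from `⊥` to `⊤`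
in which each term is normal in the next, with simple quotients. -/
structure GroupCompSeries (G : Type*) [Group G] where
  len : ℕ
  ser : Fin (len + 1) → Subgroup G
  ser_bot : ser 0 = ⊥
  ser_top : ser (Fin.last len) = ⊤
  ser_le : ∀ i : Fin len, ser i.castSucc ≤ ser i.succ
  ser_normal : ∀ i : Fin len, ((ser i.castSucc).subgroupOf (ser i.succ)).Normal
  ser_simple : ∀ i : Fin len,
    haveI := ser_normal i
    IsSimpleGroup (↥(ser i.succ) ⧸ (ser i.castSucc).subgroupOf (ser i.succ))

/-- The number of factors of order `p` in a composition series. -/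
noncomputable def GroupCompSeries.count {G : Type*} [Group G]
    (S : GroupCompSeries G) (p : ℕ) : ℕ := by
  classical
  exact (Finset.univ.filter fun i : Fin S.len =>
    Nat.card (↥(S.ser i.succ) ⧸ (S.ser i.castSucc).subgroupOf (S.ser i.succ)) = p).card

/-- `cp p G` is the number of composition factors of `G` of order `p`, counted with
multiplicity in a composition series (well defined by Jordan–Hölder). -/
noncomputable def cp (p : ℕ) (G : Type*) [Group G] : ℕ := by
  classical
  exact if h : Nonempty (GroupCompSeries G) then h.some.count p else 0

/-- The constant `ε_q` of Theorem 1, for `q = p ^ f`. -/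
noncomputable def epsq (p f : ℕ) : ℚ := by
  classical
  exact if p = 2 ∧ Even f then 4 / 3
    else if ∃ n : ℕ, p = 2 ^ 2 ^ n + 1 then p / (p - 1)
    else 1

/-- A subgroup of `GL(d, F)` acts irreducibly on its natural module. -/
def natIrreducible {F : Type*} [Field F] {d : ℕ}
    (G : Subgroup (Matrix.GeneralLinearGroup (Fin d) F)) : Prop :=
  (⊥ : Submodule F (Fin d → F)) ≠ ⊤ ∧
  ∀ W : Submodule F (Fin d → F),
    (∀ g ∈ G, ∀ v ∈ W, Matrix.mulVec (g : Matrix (Fin d) (Fin d) F) v ∈ W) →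
      W = ⊥ ∨ W = ⊤

section CompositionSeries

variable {G : Type*} [Group G]

/-- In a finite group, every subgroup `H` is reached from `⊥` by a finite subnormal chain with
simple quotients. -/
theorem Subgroup.exists_chain_simple_quotients [Finite G] (H : Subgroup G) :
    ∃ (n : ℕ) (s : ℕ → Subgroup G), s 0 = ⊥ ∧ s n = H ∧ ∀ i < n, s i ≤ s (i + 1) ∧
      ∃ _ : ((s i).subgroupOf (s (i + 1))).Normal,
        IsSimpleGroup (↥(s (i + 1)) ⧸ (s i).subgroupOf (s (i + 1))) := by
  induction H using WellFoundedLT.induction with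
  | ind H ih =>
    by_cases hH : H = ⊥
    · exact ⟨0, fun _ => ⊥, rfl, hH.symm, by simp⟩
    · obtain ⟨N, hN⟩ :=
        (Set.toFinite {N : Subgroup G | N < H ∧ (N.subgroupOf H).Normal}).exists_maximal
        ⟨⊥, bot_lt_iff_ne_bot.mpr hH, by rw [Subgroup.bot_subgroupOf]; infer_instance⟩
      obtain ⟨⟨hNH, hNn⟩, hmax⟩ := hN
      have hsimple : IsSimpleGroup (↥H ⧸ N.subgroupOf H) := by
        have hnt : Nontrivial (↥H ⧸ N.subgroupOf H) := by
          rw [QuotientGroup.nontrivial_iff, Ne, Subgroup.subgroupOf_eq_top]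
          exact hNH.not_ge
        refine ⟨fun M hM => ?_⟩
        set L : Subgroup H := M.comap (QuotientGroup.mk' (N.subgroupOf H))
        have hNL : N.subgroupOf H ≤ L := by
          rw [← QuotientGroup.ker_mk' (N.subgroupOf H)]
          exact MonoidHom.ker_le_comap _ _
        have hLn : L.Normal := hM.comap _
        have hsub : (L.map H.subtype).subgroupOf H = L :=
          Subgroup.comap_map_eq_self_of_injective H.subtype_injective L
        have hNL' : N ≤ L.map H.subtype := by
          rw [← Subgroup.map_subgroupOf_eq_of_le hNH.le]
          exact Subgroup.map_mono hNL
        have hML : M = L.map (QuotientGroup.mk' (N.subgroupOf H)) :=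
          (Subgroup.map_comap_eq_self_of_surjective (QuotientGroup.mk'_surjective _) M).symm
        rcases (Subgroup.map_subtype_le L).lt_or_eq with hlt | heq
        · left
          have hle : L.map H.subtype ≤ N := hmax ⟨hlt, by rwa [hsub]⟩ hNL'
          have hLN : L ≤ N.subgroupOf H := by
            rw [← hsub]
            exact Subgroup.comap_mono hle
          rw [hML, Subgroup.map_eq_bot_iff, QuotientGroup.ker_mk']
          exact hLN
        · right
          have hLtop : L = ⊤ := by rw [← hsub, heq, Subgroup.subgroupOf_self]
          rw [hML, hLtop, ← MonoidHom.range_eq_map, QuotientGroup.range_mk']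
      obtain ⟨n, s, h0, hn, hs⟩ := ih N hNH
      refine ⟨n + 1, fun i => if i ≤ n then s i else H, by simpa using h0, by simp, fun i hi => ?_⟩
      rcases Nat.lt_succ_iff_lt_or_eq.mp hi with hlt | rfl
      · beta_reduce
        rw [if_pos hlt.le, if_pos (Nat.succ_le_of_lt hlt)]
        exact hs i hlt
      · beta_reduce
        rw [if_pos le_rfl, if_neg (Nat.not_succ_le_self i), hn]
        exact ⟨hNH.le, hNn, hsimple⟩

instance GroupCompSeries.instNonempty [Finite G] : Nonempty (GroupCompSeries G) := by
  obtain ⟨n, s, h0, hn, hs⟩ := Subgroup.exists_chain_simple_quotients (⊤ : Subgroup G)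
  exact ⟨{ len := n
           ser := fun i => s i
           ser_bot := h0
           ser_top := hn
           ser_le := fun i => (hs i i.2).1
           ser_normal := fun i => (hs i i.2).2.1
           ser_simple := fun i => (hs i i.2).2.2 }⟩

theorem Fin.last_eq_add_sum_of_succ_eq {M : Type*} [AddCommMonoid M] {n : ℕ}
    (f : Fin (n + 1) → M) (g : Fin n → M) (h : ∀ i, f i.succ = f i.castSucc + g i) :
    f (Fin.last n) = f 0 + ∑ i, g i := by
  induction n with
  | zero => simp
  | succ n ih =>
    rw [Fin.sum_univ_castSucc, ← add_assoc, ← Fin.succ_last, h]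
    congr 1
    exact ih (fun i => f i.castSucc) (fun i => g i.castSucc) fun i => h i.castSucc

theorem IsSimpleGroup.prime_card_of_isSolvable [IsSimpleGroup G] [h : Group.IsSolvable G] :
    (Nat.card G).Prime :=
  letI : CommGroup G := { mul_comm := IsSimpleGroup.comm_iff_isSolvable.mpr h }
  IsSimpleGroup.prime_card

theorem GroupCompSeries.count_eq_factorization [Finite G] [Group.IsSolvable G]
    (S : GroupCompSeries G) (p : ℕ) :
    S.count p = (Nat.card G).factorization p := by
  classical
  have hstep (i : Fin S.len) : (Nat.card (S.ser i.succ)).factorization p =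
      (Nat.card (S.ser i.castSucc)).factorization p +
        if Nat.card (↥(S.ser i.succ) ⧸ (S.ser i.castSucc).subgroupOf (S.ser i.succ)) = p
          then 1 else 0 := by
    have := S.ser_normal i
    have := S.ser_simple i
    have hq : (Nat.card (↥(S.ser i.succ) ⧸
        (S.ser i.castSucc).subgroupOf (S.ser i.succ))).Prime :=
      IsSimpleGroup.prime_card_of_isSolvable
    rw [Subgroup.card_eq_card_quotient_mul_card_subgroup
      ((S.ser i.castSucc).subgroupOf (S.ser i.succ)),
      Nat.card_congr (Subgroup.subgroupOfEquivOfLe (S.ser_le i)).toEquiv,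
      Nat.factorization_mul hq.ne_zero Nat.card_pos.ne', Finsupp.add_apply, add_comm,
      hq.factorization, Finsupp.single_apply]
  have := Fin.last_eq_add_sum_of_succ_eq
    (fun i => (Nat.card (S.ser i)).factorization p) _ hstep
  simp only [S.ser_top, S.ser_bot, Subgroup.card_top, Subgroup.card_bot] at this
  rw [this, GroupCompSeries.count, Finset.card_filter]
  simp

theorem cp_eq_factorization [Finite G] [Group.IsSolvable G] (p : ℕ) :
    cp p G = (Nat.card G).factorization p := by
  rw [cp, dif_pos GroupCompSeries.instNonempty]
  exact GroupCompSeries.count_eq_factorization _ p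

end CompositionSeries

section SemilinearGroup

variable (F K : Type*) [Field F] [Field K] [Algebra F K]

/-- The action of the Galois group on the units of the field. -/
def galUnitsAut : Gal(K/F) →* MulAut Kˣ where
  toFun σ := Units.mapEquiv (σ : K ≃* K)
  map_one' := rfl
  map_mul' _ _ := rfl

/-- The action of `Kˣ ⋊ Gal(K/F)` on `K` by `(u, σ) • x = u * σ x`. -/
def semilinearHom : Kˣ ⋊[galUnitsAut F K] Gal(K/F) →* (K ≃ₗ[F] K) :=
  SemidirectProduct.lift (DistribMulAction.toModuleAut F K) (DistribMulAction.toModuleAut F K)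
    fun σ => by
      ext u x
      change σ u * x = σ (u * σ.symm x)
      simp

variable {F K}

theorem semilinearHom_apply (g : Kˣ ⋊[galUnitsAut F K] Gal(K/F)) (x : K) :
    semilinearHom F K g x = g.left * g.right x := rfl

variable (F K)

theorem semilinearHom_injective : Function.Injective (semilinearHom F K) := by
  intro g h hgh
  have happ (x : K) : (g.left : K) * g.right x = h.left * h.right x := by
    simpa only [semilinearHom_apply] using LinearEquiv.congr_fun hgh x
  have hleft : g.left = h.left := Units.ext (by simpa using happ 1)
  refine SemidirectProduct.ext hleft (AlgEquiv.ext fun x => ?_)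
  have := happ x
  rw [hleft] at this
  exact mul_left_cancel₀ h.left.ne_zero this

instance SemidirectProduct.isSolvable {N Q : Type*} [Group N] [Group Q] {φ : Q →* MulAut N}
    [Group.IsSolvable N] [Group.IsSolvable Q] : Group.IsSolvable (N ⋊[φ] Q) :=
  Group.isSolvable_of_ker_le_range SemidirectProduct.inl SemidirectProduct.rightHom
    SemidirectProduct.range_inl_eq_ker_rightHom.ge

variable [Fintype F] [Finite K]

theorem closure_mul_frobenius_eq_range_semilinearHom :
    Subgroup.closure { f : K ≃ₗ[F] K |
      (∃ u : K, u ≠ 0 ∧ ∀ x, f x = u * x) ∨ (∀ x, f x = x ^ Fintype.card F) } =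
      (semilinearHom F K).range := by
  apply le_antisymm
  · rw [Subgroup.closure_le]
    rintro f (⟨u, hu, hf⟩ | hf)
    · exact ⟨SemidirectProduct.inl (Units.mk0 u hu), by ext x; simp [semilinearHom_apply, hf]⟩
    · refine ⟨SemidirectProduct.inr (FiniteField.frobeniusAlgEquivOfAlgebraic F K), ?_⟩
      ext x
      simp [semilinearHom_apply, hf]
  · rintro _ ⟨g, rfl⟩
    rw [← SemidirectProduct.inl_left_mul_inr_right g, map_mul]
    obtain ⟨n, hn⟩ := (FiniteField.bijective_frobeniusAlgEquivOfAlgebraic_pow F K).2 g.right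
    refine Subgroup.mul_mem _ (Subgroup.subset_closure <| Or.inl
      ⟨g.left, g.left.ne_zero, fun x => by simp [semilinearHom_apply]⟩) ?_
    rw [← hn]
    dsimp only
    rw [map_pow, map_pow]
    refine Subgroup.pow_mem _ (Subgroup.subset_closure ?_) _
    exact Or.inr fun x => by simp [semilinearHom_apply]

end SemilinearGroup

section AbsoluteIrreducibility

open scoped TensorProduct

variable {F K : Type*} [Field F] [Field K] [Algebra F K] [FiniteDimensional F K] [IsGalois F K]
  (E : Type*) [Field E] [Algebra F E]

theorem sum_gal_baseChange_traceDual_mul {ι : Type*} [Fintype ι] [DecidableEq ι]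
    (b : Module.Basis ι F K) (w : E ⊗[F] K) (j : ι) :
    ∑ σ : Gal(K/F),
        LinearMap.baseChange E (σ.toLinearMap ∘ₗ LinearMap.mul F K (b.traceDual j)) w =
      ((Algebra.TensorProduct.basis E b).repr w j) ⊗ₜ[F] (1 : K) := by
  have h : ∑ σ : Gal(K/F),
      LinearMap.baseChange E (σ.toLinearMap ∘ₗ LinearMap.mul F K (b.traceDual j)) =
      (LinearMap.toSpanSingleton E (E ⊗[F] K) (1 ⊗ₜ[F] (1 : K))) ∘ₗ
        (Algebra.TensorProduct.basis E b).coord j := by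
    refine (Algebra.TensorProduct.basis E b).ext fun i => ?_
    have htr := trace_eq_sum_automorphisms (K := F) (b.traceDual j * b i)
    rw [Module.Basis.trace_traceDual_mul] at htr
    simp only [LinearMap.sum_apply, LinearMap.coe_comp, Function.comp_apply,
      Module.Basis.coord_apply, Module.Basis.repr_self, Finsupp.single_apply]
    simp only [Algebra.TensorProduct.basis_apply, LinearMap.baseChange_tmul, LinearMap.comp_apply,
      LinearMap.mul_apply', AlgEquiv.toLinearMap_apply, ← TensorProduct.tmul_sum]
    rw [← htr]
    split_ifs <;> simp
  have := LinearMap.congr_fun h w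
  simpa [TensorProduct.smul_tmul'] using this

/-- A subspace of `E ⊗ K` stable under multiplications by `Kˣ` and under `Gal(K/F)` is trivial. -/
theorem eq_bot_or_eq_top_of_semilinear_stable (W : Submodule E (E ⊗[F] K))
    (hW : ∀ f ∈ (semilinearHom F K).range, ∀ v ∈ W,
      LinearMap.baseChange E f.toLinearMap v ∈ W) : W = ⊥ ∨ W = ⊤ := by
  classical
  rw [or_iff_not_imp_left]
  intro hne
  obtain ⟨w, hw, hw0⟩ := W.exists_mem_ne_zero_of_ne_bot hne
  have hmul (u : Kˣ) (σ : Gal(K/F)) (v : E ⊗[F] K) (hv : v ∈ W) :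
      LinearMap.baseChange E (σ.toLinearMap ∘ₗ LinearMap.mul F K u) v ∈ W := by
    have heq : σ.toLinearMap ∘ₗ LinearMap.mul F K u = (semilinearHom F K
        (SemidirectProduct.inr σ * SemidirectProduct.inl u)).toLinearMap := by
      ext x
      simp [semilinearHom_apply]
    rw [heq]
    exact hW _ ⟨_, rfl⟩ v hv
  set b := Module.finBasis F K
  obtain ⟨j, hj⟩ : ∃ j, (Algebra.TensorProduct.basis E b).repr w j ≠ 0 := by
    by_contra! hall
    exact hw0 ((Algebra.TensorProduct.basis E b).repr.map_eq_zero_iff.mp (Finsupp.ext hall))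
  have hone : (1 : E) ⊗ₜ[F] (1 : K) ∈ W := by
    have hmem : ((Algebra.TensorProduct.basis E b).repr w j) ⊗ₜ[F] (1 : K) ∈ W := by
      rw [← sum_gal_baseChange_traceDual_mul E b w j]
      exact W.sum_mem fun σ _ => hmul (Units.mk0 _ (b.traceDual.ne_zero j)) σ w hw
    simpa [TensorProduct.smul_tmul', hj] using
      W.smul_mem ((Algebra.TensorProduct.basis E b).repr w j)⁻¹ hmem
  rw [eq_top_iff, ← (Algebra.TensorProduct.basis E b).span_eq, Submodule.span_le]
  rintro _ ⟨i, rfl⟩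
  simpa using hmul (Units.mk0 _ (b.ne_zero i)) 1 _ hone

end AbsoluteIrreducibility

open scoped TensorProduct in
/-- **Example 5 (Ex3).**  Let `K = F_{p^p}` and let `G = ΓL(1, p^p)` be the subgroup of
`GL(K) ≅ GL(p, p)` generated by the multiplications `x ↦ λx` (`λ ∈ K ^ ×`) and the
Frobenius map `x ↦ x ^ p`.  Then `|G| = (p^p − 1)·p`, `G` acts absolutely irreducibly on
`K` (after any base field extension `E` of `F_p` the module `E ⊗ K` is simple), and
`c_p(G) = 1`. -/
theorem gammaL_one_p_pow_p_absolutely_irreducible_and_cp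
    (p : ℕ) [hp : Fact p.Prime]
    (G : Subgroup (GaloisField p p ≃ₗ[ZMod p] GaloisField p p))
    (hG : G = Subgroup.closure
      { f : GaloisField p p ≃ₗ[ZMod p] GaloisField p p |
        (∃ u : GaloisField p p, u ≠ 0 ∧ ∀ x, f x = u * x) ∨ (∀ x, f x = x ^ p) }) :
    Nat.card ↥G = (p ^ p - 1) * p ∧
    (∀ (E : Type) [Field E] [Algebra (ZMod p) E],
      (⊥ : Submodule E (E ⊗[ZMod p] GaloisField p p)) ≠ ⊤ ∧
      ∀ W : Submodule E (E ⊗[ZMod p] GaloisField p p),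
        (∀ f ∈ G, ∀ v ∈ W,
          LinearMap.baseChange E (f : GaloisField p p ≃ₗ[ZMod p] GaloisField p p).toLinearMap v ∈ W) →
          W = ⊥ ∨ W = ⊤) ∧
    cp p ↥G = 1 := by
  have hF : Finite (GaloisField p p) :=
    Module.finite_of_finite (ZMod p)
  have hrange : G = (semilinearHom (ZMod p) (GaloisField p p)).range := by
    rw [hG, ← closure_mul_frobenius_eq_range_semilinearHom, ZMod.card]
  let e := MonoidHom.ofInjective (semilinearHom_injective (ZMod p) (GaloisField p p))
  have hcard : Nat.card G = (p ^ p - 1) * p := by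
    rw [hrange, ← Nat.card_congr e.toEquiv, SemidirectProduct.card, Nat.card_units,
      GaloisField.card p p hp.out.ne_zero, IsGalois.card_aut_eq_finrank,
      GaloisField.finrank p hp.out.ne_zero]
  refine ⟨hcard, fun E _ _ => ⟨bot_ne_top, fun W hW =>
    eq_bot_or_eq_top_of_semilinear_stable E W (hrange ▸ hW)⟩, ?_⟩
  have hsolv : Group.IsSolvable G := by
    have : Group.IsSolvable Gal(GaloisField p p/ZMod p) :=
      Group.isSolvable_of_comm fun a b => (IsCyclic.commGroup).mul_comm a b
    rw [hrange]
    exact Group.isSolvable_of_surjective (f := e.toMonoidHom) e.surjective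
  have hpp : 1 < p ^ p := Nat.one_lt_pow hp.out.ne_zero hp.out.one_lt
  have hfin : Finite G :=
    Nat.finite_of_card_ne_zero (hcard ▸ mul_ne_zero (Nat.sub_pos_of_lt hpp).ne' hp.out.ne_zero)
  have hndvd : ¬ p ∣ p ^ p - 1 := fun h => hp.out.one_lt.ne' <| Nat.dvd_one.mp <| by
    simpa [Nat.sub_sub_self hpp.le] using Nat.dvd_sub (dvd_pow_self p hp.out.ne_zero) h
  rw [cp_eq_factorization p, hcard,
    Nat.factorization_mul (Nat.sub_pos_of_lt hpp).ne' hp.out.ne_zero, Finsupp.add_apply,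
    Nat.factorization_eq_zero_of_not_dvd hndvd, hp.out.factorization_self]
end

section
/- Let p be a prime and let q be any power of p. For every integer n ≥ 1 there exists an irreducible subgroup G of GL(d,q) with d = p^n such that (p−1)·c_p(G) = d − 1. -/
open Function

section CompositionSeries

variable {G : Type*} [Group G]

theorem exists_maximal_normal_subgroup (G : Type*) [Group G] [Finite G] [Nontrivial G] :
    ∃ N : Subgroup G, ∃ _ : N.Normal, N ≠ ⊤ ∧ IsSimpleGroup (G ⧸ N) := by
  obtain ⟨N, ⟨hN, hNtop⟩, hmax⟩ :=
    (Set.toFinite {N : Subgroup G | N.Normal ∧ N ≠ ⊤}).exists_maximal ⟨⊥, inferInstance, bot_ne_top⟩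
  refine ⟨N, hN, hNtop, ?_⟩
  have : Nontrivial (G ⧸ N) := QuotientGroup.nontrivial_iff.mpr hNtop
  refine ⟨fun M hM => ?_⟩
  by_cases h : M.comap (QuotientGroup.mk' N) = ⊤
  · right
    rw [← Subgroup.map_comap_eq_self_of_surjective (QuotientGroup.mk'_surjective N) M, h,
      Subgroup.map_top_of_surjective _ (QuotientGroup.mk'_surjective N)]
  · left
    have hle : M.comap (QuotientGroup.mk' N) ≤ N :=
      hmax ⟨hM.comap _, h⟩ (QuotientGroup.le_comap_mk' N M)
    rw [eq_bot_iff, ← Subgroup.map_comap_eq_self_of_surjective (QuotientGroup.mk'_surjective N) M]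
    exact (Subgroup.map_mono hle).trans (by simp)

/-- `A` is a normal subgroup of `B` with simple quotient. -/
def IsCompStep (A B : Subgroup G) : Prop :=
  A ≤ B ∧ ∃ _ : (A.subgroupOf B).Normal, IsSimpleGroup (B ⧸ A.subgroupOf B)

theorem exists_isCompStep_lt [Finite G] (H : Subgroup G) (hH : H ≠ ⊥) :
    ∃ N < H, IsCompStep N H := by
  have : Nontrivial H := (Subgroup.nontrivial_iff_ne_bot H).mpr hH
  obtain ⟨N, hN, hNtop, hs⟩ := exists_maximal_normal_subgroup H
  have hle : N.map H.subtype ≤ H := Subgroup.map_subtype_le N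
  have heq : (N.map H.subtype).subgroupOf H = N :=
    Subgroup.comap_map_eq_self_of_injective H.subtype_injective N
  refine ⟨N.map H.subtype, lt_of_le_of_ne hle fun h => hNtop ?_, hle, ?_⟩
  · rw [← heq, h, Subgroup.subgroupOf_self]
  · rw [heq]
    exact ⟨hN, hs⟩

theorem exists_compSteps [Finite G] (H : Subgroup G) :
    ∃ (l : ℕ) (s : ℕ → Subgroup G), s 0 = ⊥ ∧ s l = H ∧
      ∀ i < l, IsCompStep (s i) (s (i + 1)) := by
  induction H using WellFoundedLT.induction with
  | ind H ih =>
    by_cases hH : H = ⊥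
    · exact ⟨0, fun _ => ⊥, rfl, hH.symm, by simp⟩
    · obtain ⟨N, hN, hstep⟩ := exists_isCompStep_lt H hH
      obtain ⟨l, s, h0, hl, hs⟩ := ih N hN
      refine ⟨l + 1, fun i => if i ≤ l then s i else H, by simp [h0], by simp, fun i hi => ?_⟩
      rcases Nat.lt_succ_iff_lt_or_eq.mp hi with h | rfl
      · simpa [h.le, Nat.succ_le_of_lt h] using hs i h
      · simpa [hl] using hstep

theorem nonempty_groupCompSeries (G : Type*) [Group G] [Finite G] :
    Nonempty (GroupCompSeries G) := by
  obtain ⟨l, s, h0, hl, hs⟩ := exists_compSteps (⊤ : Subgroup G)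
  exact ⟨{
    len := l
    ser := fun i => s i
    ser_bot := h0
    ser_top := hl
    ser_le := fun i => (hs i i.2).1
    ser_normal := fun i => (hs i i.2).2.1
    ser_simple := fun i => (hs i i.2).2.2 }⟩

theorem GroupCompSeries.count_eq_padicValNat [Finite G] [Group.IsSolvable G]
    (S : GroupCompSeries G) {p : ℕ} (hp : p.Prime) :
    S.count p = padicValNat p (Nat.card G) := by
  have := Fact.mk hp
  have hstep : ∀ i : Fin S.len, padicValNat p (Nat.card (S.ser i.succ)) =
      (if Nat.card (↥(S.ser i.succ) ⧸ (S.ser i.castSucc).subgroupOf (S.ser i.succ)) = p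
        then 1 else 0) + padicValNat p (Nat.card (S.ser i.castSucc)) := by
    intro i
    have := S.ser_normal i
    have := S.ser_simple i
    have hcomm := (IsSimpleGroup.comm_iff_isSolvable
      (G := ↥(S.ser i.succ) ⧸ (S.ser i.castSucc).subgroupOf (S.ser i.succ))).mpr inferInstance
    have : IsMulCommutative (↥(S.ser i.succ) ⧸ (S.ser i.castSucc).subgroupOf (S.ser i.succ)) :=
      ⟨⟨hcomm⟩⟩
    have hprime := (Group.is_simple_iff_prime_card
      (α := ↥(S.ser i.succ) ⧸ (S.ser i.castSucc).subgroupOf (S.ser i.succ))).mp inferInstance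
    rw [Subgroup.card_eq_card_quotient_mul_card_subgroup
        ((S.ser i.castSucc).subgroupOf (S.ser i.succ)),
      padicValNat.mul hprime.ne_zero Nat.card_pos.ne',
      Nat.card_congr (Subgroup.subgroupOfEquivOfLe (S.ser_le i)).toEquiv]
    congr 1
    split_ifs with h
    · rw [h, padicValNat_self]
    · have := Fact.mk hprime
      exact padicValNat_primes (Ne.symm h)
  have hsum := Finset.sum_congr rfl fun i (_ : i ∈ Finset.univ) => hstep i
  have h1 := Fin.sum_univ_succ fun i => padicValNat p (Nat.card (S.ser i))
  have h2 := Fin.sum_univ_castSucc fun i => padicValNat p (Nat.card (S.ser i))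
  rw [Finset.sum_add_distrib, ← Finset.card_filter] at hsum
  simp only [S.ser_bot, S.ser_top, Subgroup.card_bot, Subgroup.card_top, padicValNat_one_right] at h1 h2
  unfold GroupCompSeries.count
  omega

theorem cp_eq_padicValNat (G : Type*) [Group G] [Finite G] [Group.IsSolvable G] {p : ℕ}
    (hp : p.Prime) : cp p G = padicValNat p (Nat.card G) := by
  rw [cp, dif_pos (nonempty_groupCompSeries G), GroupCompSeries.count_eq_padicValNat _ hp]

end CompositionSeries

section Solvable

theorem isSolvable_pi (ι H : Type*) [Group H] [Group.IsSolvable H] :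
    Group.IsSolvable (ι → H) := by
  obtain ⟨n, hn⟩ := (Group.isSolvable_def H).mp inferInstance
  refine (Group.isSolvable_def _).mpr ⟨n, eq_bot_iff.mpr fun x hx => ?_⟩
  refine Subgroup.mem_bot.mpr (funext fun i => ?_)
  have := map_derivedSeries_le_derivedSeries (Pi.evalMonoidHom (fun _ : ι => H) i) n
    (Subgroup.mem_map_of_mem _ hx)
  rwa [hn, Subgroup.mem_bot] at this

theorem isSolvable_semidirectProduct {N G : Type*} [Group N] [Group G] (φ : G →* MulAut N)
    [Group.IsSolvable N] [Group.IsSolvable G] : Group.IsSolvable (N ⋊[φ] G) :=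
  Group.isSolvable_of_ker_le_range SemidirectProduct.inl SemidirectProduct.rightHom
    SemidirectProduct.range_inl_eq_ker_rightHom.ge

end Solvable

section Representations

variable {F : Type*} [Field F]

/-- A group homomorphism to `Module.End F V` is irreducible if the only invariant subspaces
are the trivial ones. -/
def IsIrreducibleAction {Γ V : Type*} [Group Γ] [AddCommGroup V] [Module F V]
    (ρ : Γ →* Module.End F V) : Prop :=
  ∀ W : Submodule F V, (∀ g, ∀ v ∈ W, ρ g v ∈ W) → W = ⊥ ∨ W = ⊤

/-- A faithful irreducible representation of a finite solvable group gives an irreducible matrix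
group whose number of composition factors of order `p` is read off from the group order. -/
theorem exists_natIrreducible_of_faithful {Γ V : Type*} [Group Γ] [Finite Γ]
    [Group.IsSolvable Γ] [AddCommGroup V] [Module F V] {d : ℕ} (hd : d ≠ 0)
    (b : Module.Basis (Fin d) F V) (ρ : Γ →* Module.End F V) (hinj : Injective ρ)
    (hirr : IsIrreducibleAction ρ) {p : ℕ} (hp : p.Prime) :
    ∃ G : Subgroup (Matrix.GeneralLinearGroup (Fin d) F),
      natIrreducible G ∧ cp p G = padicValNat p (Nat.card Γ) := by
  let Φ : Γ →* Matrix.GeneralLinearGroup (Fin d) F :=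
    MonoidHom.toHomUnits (((LinearMap.toMatrixAlgEquiv b : _ →* _).comp ρ))
  have hΦ : ∀ g v, Matrix.mulVec (Φ g : Matrix (Fin d) (Fin d) F) (b.equivFun v) =
      b.equivFun (ρ g v) := fun g v => LinearMap.toMatrix_mulVec_repr b b (ρ g) v
  have hΦinj : Injective Φ := by
    intro g h hgh
    refine hinj (LinearMap.ext fun v => b.equivFun.injective ?_)
    rw [← hΦ, ← hΦ, hgh]
  have e : Γ ≃* Φ.range := MonoidHom.ofInjective hΦinj
  have : Finite Φ.range := Finite.of_equiv _ e.toEquiv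
  have : Group.IsSolvable Φ.range := Group.isSolvable_of_surjective (f := e.toMonoidHom) e.surjective
  refine ⟨Φ.range, ⟨?_, fun W hW => ?_⟩, ?_⟩
  · have : NeZero d := ⟨hd⟩
    exact bot_ne_top
  · have hmap : (W.comap b.equivFun.toLinearMap).map b.equivFun.toLinearMap = W :=
      Submodule.map_comap_eq_of_surjective b.equivFun.surjective W
    rcases hirr (W.comap b.equivFun.toLinearMap) fun g v hv => by
      have := hW _ ⟨g, rfl⟩ _ hv
      rwa [LinearEquiv.coe_coe, hΦ] at this with h | h
    · left
      rw [← hmap, h, Submodule.map_bot]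
    · right
      rw [← hmap, h, Submodule.map_top, LinearEquiv.range]
  · rw [cp_eq_padicValNat _ hp, Nat.card_congr e.toEquiv]

variable {H U ι : Type*} [Group H] [AddCommGroup U] [Module F U]

/-- The imprimitive action of the wreath product of `H` with a permutation group `P` of `ι`
on `ι → U`, for a linear action of `H` on `U`. -/
def wreathAction (ρ : H →* Module.End F U) (P : Subgroup (Equiv.Perm ι)) :
    ((ι → H) ⋊[mulAutArrow] P) →* Module.End F (ι → U) where
  toFun g :=
    { toFun := fun v i => ρ (g.left i) (v ((g.right : Equiv.Perm ι)⁻¹ i))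
      map_add' := fun v w => funext fun i => by simp
      map_smul' := fun c v => funext fun i => by simp }
  map_one' := by
    ext v i
    simp
  map_mul' g h := by
    refine LinearMap.ext fun v => funext fun i => ?_
    simp only [SemidirectProduct.mul_left, SemidirectProduct.mul_right, Pi.mul_apply, map_mul,
      Subgroup.coe_mul, mul_inv_rev, Equiv.Perm.mul_apply, Module.End.mul_apply]
    rfl

theorem wreathAction_apply (ρ : H →* Module.End F U) (P : Subgroup (Equiv.Perm ι))
    (g : (ι → H) ⋊[mulAutArrow] P) (v : ι → U) (i : ι) :
    wreathAction ρ P g v i = ρ (g.left i) (v ((g.right : Equiv.Perm ι)⁻¹ i)) :=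
  rfl

theorem wreathAction_injective [Nontrivial U] {ρ : H →* Module.End F U} (hρ : Injective ρ)
    (P : Subgroup (Equiv.Perm ι)) : Injective (wreathAction ρ P) := by
  classical
  refine (injective_iff_map_eq_one _).mpr fun g hg => ?_
  have hv : ∀ (v : ι → U) (i : ι), ρ (g.left i) (v ((g.right : Equiv.Perm ι)⁻¹ i)) = v i := fun v i => by
    rw [← wreathAction_apply, hg, Module.End.one_apply]
  have hright : g.right = 1 := by
    refine Subtype.ext (inv_eq_one.mp (Equiv.ext fun i => ?_))
    by_contra hne
    change (g.right : Equiv.Perm ι)⁻¹ i ≠ i at hne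
    obtain ⟨u, hu⟩ := exists_ne (0 : U)
    have := hv (Pi.single i u) i
    rw [Pi.single_eq_same, Pi.single_eq_of_ne hne, map_zero] at this
    exact hu this.symm
  refine SemidirectProduct.ext (funext fun i => hρ (LinearMap.ext fun u => ?_)) hright
  simpa [hright] using hv (fun _ => u) i

theorem wreathAction_isIrreducible [Finite ι] {ρ : H →* Module.End F U}
    (hρ : IsIrreducibleAction ρ) (hfix : ∀ u ≠ 0, ∃ h, ρ h u ≠ u)
    (P : Subgroup (Equiv.Perm ι)) (hP : ∀ i j, ∃ π ∈ P, π i = j) :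
    IsIrreducibleAction (wreathAction ρ P) := by
  classical
  intro W hW
  refine or_iff_not_imp_left.mpr fun hne => ?_
  obtain ⟨w, hw, hw0⟩ := W.exists_mem_ne_zero_of_ne_bot hne
  obtain ⟨i, hi⟩ := Function.ne_iff.mp hw0
  have hbase : ∀ (j : ι) (h : H) (v : ι → U), wreathAction ρ P
      (SemidirectProduct.inl (Pi.mulSingle j h)) v = v + Pi.single j (ρ h (v j) - v j) := by
    intro j h v
    funext k
    rcases eq_or_ne k j with rfl | hk
    · simp [wreathAction_apply]
    · simp [wreathAction_apply, hk]
  have hsingle : ∀ u, Pi.single i u ∈ W := by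
    obtain ⟨h, hh⟩ := hfix (w i) hi
    have hmem : Pi.single i (ρ h (w i) - w i) ∈ W := by
      have := W.sub_mem (hW (SemidirectProduct.inl (Pi.mulSingle i h)) w hw) hw
      rwa [hbase, add_sub_cancel_left] at this
    rcases hρ (W.comap (LinearMap.single F (fun _ => U) i)) fun g u hu => by
      have := hW (SemidirectProduct.inl (Pi.mulSingle i g)) _ hu
      rwa [hbase, LinearMap.single_apply, Pi.single_eq_same, ← Pi.single_add,
        add_sub_cancel] at this with hbot | htop
    · have : ρ h (w i) - w i ∈ W.comap (LinearMap.single F (fun _ => U) i) := hmem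
      rw [hbot, Submodule.mem_bot, sub_eq_zero] at this
      exact absurd this hh
    · intro u
      have : u ∈ W.comap (LinearMap.single F (fun _ => U) i) := htop ▸ Submodule.mem_top
      exact this
  have hall : ∀ j u, Pi.single j u ∈ W := by
    intro j u
    obtain ⟨π, hπ, rfl⟩ := hP i j
    convert hW (SemidirectProduct.inr ⟨π, hπ⟩) _ (hsingle u) using 1
    funext k
    rcases eq_or_ne k (π i) with rfl | hk
    · simp [wreathAction_apply]
    · have : π.symm k ≠ i := fun h => hk (π.symm_apply_eq.mp h)
      simp [wreathAction_apply, hk, this]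
  have := Fintype.ofFinite ι
  refine eq_top_iff.mpr fun v _ => ?_
  rw [← Finset.univ_sum_single v]
  exact W.sum_mem fun j _ => hall j (v j)

end Representations

section SemilinearGroup

variable (F K : Type*) [Field F] [Field K] [Algebra F K]

/-- The group of semilinear transformations `x ↦ a * σ x` of `K`, with `σ` fixing `F`. -/
abbrev GammaL : Type _ := Kˣ ⋊[MulDistribMulAction.toMulAut Gal(K/F) Kˣ] Gal(K/F)

/-- The action of semilinear transformations on `K` as an `F`-vector space. -/
def gammaLAction : GammaL F K →* Module.End F K where
  toFun g := LinearMap.mulLeft F (g.left : K) ∘ₗ g.right.toLinearMap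
  map_one' := by
    ext x
    simp
  map_mul' g h := by
    ext x
    simp

variable {F K}

theorem gammaLAction_apply (g : GammaL F K) (x : K) :
    gammaLAction F K g x = g.left * g.right x :=
  rfl

theorem gammaLAction_injective : Injective (gammaLAction F K) := by
  refine (injective_iff_map_eq_one _).mpr fun g hg => ?_
  have hx : ∀ x, (g.left : K) * g.right x = x := fun x => by
    rw [← gammaLAction_apply, hg, Module.End.one_apply]
  have hleft : g.left = 1 := Units.ext (by simpa using hx 1)
  refine SemidirectProduct.ext hleft (AlgEquiv.ext fun x => ?_)
  simpa [hleft] using hx x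

theorem gammaLAction_inl (a : Kˣ) (x : K) :
    gammaLAction F K (SemidirectProduct.inl a) x = a * x :=
  rfl

theorem gammaLAction_isIrreducible : IsIrreducibleAction (gammaLAction F K) := by
  intro W hW
  refine or_iff_not_imp_left.mpr fun hne => eq_top_iff.mpr fun x _ => ?_
  obtain ⟨w, hw, hw0⟩ := W.exists_mem_ne_zero_of_ne_bot hne
  rcases eq_or_ne x 0 with rfl | hx
  · exact W.zero_mem
  · have := hW (SemidirectProduct.inl (Units.mk0 (x / w) (div_ne_zero hx hw0))) w hw
    rwa [gammaLAction_inl, Units.val_mk0, div_mul_cancel₀ x hw0] at this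

theorem gammaLAction_exists_ne [Nontrivial Kˣ] (x : K) (hx : x ≠ 0) :
    ∃ g, gammaLAction F K g x ≠ x := by
  obtain ⟨a, ha⟩ := exists_ne (1 : Kˣ)
  refine ⟨SemidirectProduct.inl a, fun h => ha (Units.ext ?_)⟩
  rw [gammaLAction_inl] at h
  exact mul_right_cancel₀ hx (h.trans (one_mul x).symm)

end SemilinearGroup

section SylowPerm

variable {p : ℕ} [Fact p.Prime]

theorem exists_transitive_sylow_perm (m : ℕ) :
    ∃ P : Sylow p (Equiv.Perm (ZMod (p ^ m))), ∀ i j, ∃ π ∈ (P : Subgroup (Equiv.Perm (ZMod (p ^ m)))), π i = j := by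
  have : NeZero (p ^ m) := ⟨pow_ne_zero m (Fact.out (p := p.Prime)).ne_zero⟩
  let τ : Multiplicative (ZMod (p ^ m)) →* Equiv.Perm (ZMod (p ^ m)) :=
    (AddAction.toPermHom (ZMod (p ^ m)) (ZMod (p ^ m))).toMultiplicativeLeft
  have hp : IsPGroup p (Multiplicative (ZMod (p ^ m))) :=
    IsPGroup.of_card (n := m) (by simp)
  obtain ⟨P, hP⟩ := (hp.of_surjective τ.rangeRestrict τ.rangeRestrict_surjective).exists_le_sylow
  refine ⟨P, fun i j => ⟨τ (Multiplicative.ofAdd (j - i)), hP ⟨_, rfl⟩, ?_⟩⟩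
  exact sub_add_cancel j i

theorem sub_one_mul_padicValNat_factorial_pow (m : ℕ) :
    (p - 1) * padicValNat p (p ^ m).factorial = p ^ m - 1 := by
  have hp := (Fact.out (p := p.Prime)).one_lt
  have hd := Nat.digits_base_pow_mul (b := p) (k := m) (m := 1) hp one_pos
  rw [mul_one] at hd
  rw [sub_one_mul_padicValNat_factorial, hd, Nat.digits_of_lt p 1 one_ne_zero hp]
  simp

theorem Sylow.padicValNat_card {G : Type*} [Group G] [Finite G] (P : Sylow p G) :
    padicValNat p (Nat.card P) = padicValNat p (Nat.card G) := by
  rw [P.card_eq_multiplicity, padicValNat.prime_pow, Nat.factorization_def _ Fact.out]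

end SylowPerm

/-- **Example (Ex3).**  For every power `q = p ^ f` of a prime `p` and every `n ≥ 1` there
is an irreducible subgroup `G` of `GL(p^n, q)` with `(p − 1)·c_p(G) = p^n − 1`. -/
theorem exists_irreducible_subgroup_cp_eq (p f n : ℕ) (hp : p.Prime) (hf : 0 < f)
    (hn : 1 ≤ n) (F : Type) [Field F] [Fintype F] (hF : Fintype.card F = p ^ f) :
    ∃ G : Subgroup (Matrix.GeneralLinearGroup (Fin (p ^ n)) F),
      natIrreducible G ∧ (p - 1) * cp p ↥G = p ^ n - 1 := by
  obtain ⟨m, rfl⟩ := Nat.exists_eq_add_of_le' hn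
  have := Fact.mk hp
  have : NeZero p := ⟨hp.ne_zero⟩
  have : NeZero (p ^ m) := ⟨pow_ne_zero m hp.ne_zero⟩
  have : CharP F p := charP_of_card_eq_prime_pow hF
  let K := FiniteField.Extension F p p
  have hF' : Nat.card F = p ^ f := by rw [Nat.card_eq_fintype_card, hF]
  have hK : Nat.card K = (p ^ f) ^ p := by rw [FiniteField.natCard_extension, hF']
  have hunits : Nat.card Kˣ = (p ^ f) ^ p - 1 := by rw [Nat.card_units, hK]
  have hpf : p ≤ p ^ f := Nat.le_self_pow hf.ne' p
  have hfour : 4 ≤ (p ^ f) ^ p :=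
    calc 4 = 2 ^ 2 := rfl
      _ ≤ (p ^ f) ^ 2 := Nat.pow_le_pow_left (hp.two_le.trans hpf) 2
      _ ≤ (p ^ f) ^ p := Nat.pow_le_pow_right (hp.pos.trans_le hpf) hp.two_le
  have : Nontrivial Kˣ := Finite.one_lt_card_iff_nontrivial.mp (by rw [hunits]; omega)
  have hvunits : padicValNat p (Nat.card Kˣ) = 0 := by
    refine padicValNat.eq_zero_of_not_dvd fun hdvd => hp.one_lt.ne' ?_
    have hpow : p ∣ (p ^ f) ^ p := (dvd_pow_self p hf.ne').trans (dvd_pow_self _ hp.ne_zero)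
    rw [hunits] at hdvd
    exact Nat.dvd_one.mp ((Nat.dvd_sub_iff_right (by omega) hpow).mp hdvd)
  have hvGamma : padicValNat p (Nat.card (GammaL F K)) = 1 := by
    rw [SemidirectProduct.card, padicValNat.mul Nat.card_pos.ne' Nat.card_pos.ne', hvunits,
      FiniteField.natCard_algEquiv_extension, padicValNat_self]
  obtain ⟨P, hP⟩ := exists_transitive_sylow_perm (p := p) m
  have : Finite (GammaL F K) := Finite.of_equiv _ SemidirectProduct.equivProd.symm
  have : Finite ((ZMod (p ^ m) → GammaL F K) ⋊[mulAutArrow] (P : Subgroup (Equiv.Perm (ZMod (p ^ m))))) :=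
    Finite.of_equiv _ SemidirectProduct.equivProd.symm
  have : Group.IsSolvable Gal(K/F) := inferInstance
  have : Group.IsSolvable (GammaL F K) := isSolvable_semidirectProduct _
  have : Group.IsSolvable (ZMod (p ^ m) → GammaL F K) := isSolvable_pi _ _
  have : Group.IsNilpotent P := P.isPGroup'.isNilpotent
  have : Group.IsSolvable ((ZMod (p ^ m) → GammaL F K) ⋊[mulAutArrow] (P : Subgroup (Equiv.Perm (ZMod (p ^ m))))) :=
    isSolvable_semidirectProduct _
  have hrank : Module.finrank F (ZMod (p ^ m) → K) = p ^ (m + 1) := by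
    rw [Module.finrank_pi_fintype]
    simp [K, FiniteField.finrank_extension, ZMod.card, pow_succ]
  obtain ⟨G, hG, hcp⟩ := exists_natIrreducible_of_faithful (pow_ne_zero (m + 1) hp.ne_zero)
    (Module.finBasisOfFinrankEq F _ hrank) (wreathAction (gammaLAction F K) P)
    (wreathAction_injective gammaLAction_injective _)
    (wreathAction_isIrreducible gammaLAction_isIrreducible gammaLAction_exists_ne _ hP) hp
  refine ⟨G, hG, ?_⟩
  have hfact := sub_one_mul_padicValNat_factorial_pow (p := p) m
  rw [hcp, SemidirectProduct.card, padicValNat.mul Nat.card_pos.ne' Nat.card_pos.ne',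
    P.padicValNat_card, Nat.card_perm, Nat.card_zmod, Nat.card_fun, Nat.card_zmod,
    padicValNat.pow, hvGamma, mul_add, hfact, mul_one, pow_succ, mul_comm (p - 1),
    Nat.mul_sub_one]
  have h1 : 1 ≤ p ^ m := Nat.one_le_pow _ _ hp.pos
  have h2 : p ^ m ≤ p ^ m * p := Nat.le_mul_of_pos_right _ hp.pos
  omega
end
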